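/- Let d > 1, e > 1 and n ≥ 2. For every w ∈ G(de,e,n), write w = z^k · a₂ ⋯ aₙ in its normal form with 0 ≤ k ≤ d−1 and aᵢ one of the listed expressions of Λᵢ. Then the word over X obtained by concatenating k copies of z with the defining words of a₂, …, aₙ is a geodesic: its number of letters equals ℓ(w). Here the defining word of aᵢ has 0 letters if aᵢ = 1, has i − i' + 1 letters if aᵢ = sᵢ ⋯ s_{i'}, has (i − 2) + 1 letters if aᵢ = sᵢ ⋯ s₃ t_k, and has (i − 2) + 2 + (i' − 2) letters if aᵢ = sᵢ ⋯ s₃ t_k s₂ s₃ ⋯ s_{i'}. -/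

import Mathlib

noncomputable section

open Complex Matrix

/-- ζ_m = exp(2πi/m). -/
def zetaC (m : ℕ) : ℂ := Complex.exp (2 * Real.pi * Complex.I / m)

/-- The complex reflection group `G(de,e,n)` realized as a set of monomial matrices:
exactly one nonzero entry in each row and column, the nonzero entries are `de`-th roots
of unity and their product is a `d`-th root of unity. -/
def Gdeen (d e n : ℕ) : Set (Matrix (Fin n) (Fin n) ℂ) :=
  {w | ∃ σ : Equiv.Perm (Fin n),
    (∀ i j, w i j ≠ 0 ↔ j = σ i) ∧
    (∀ i, (w i (σ i)) ^ (d * e) = 1) ∧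
    (∏ i, w i (σ i)) ^ d = 1}

/-- The diagonal matrix `z = diag(ζ_d, 1, …, 1)`. -/
def zMat (d n : ℕ) : Matrix (Fin n) (Fin n) ℂ :=
  Matrix.of fun i j => if i = j then (if (i : ℕ) = 0 then zetaC d else 1) else 0

/-- The generator `t_k` of `G(de,e,n)`: identity outside the top-left 2×2 block,
with top-left block `[[0, ζ_{de}^{-k}], [ζ_{de}^{k}, 0]]`. -/
def tMat (de n k : ℕ) : Matrix (Fin n) (Fin n) ℂ :=
  Matrix.of fun i j =>
    if (i : ℕ) = 0 ∧ (j : ℕ) = 1 then (zetaC de ^ k)⁻¹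
    else if (i : ℕ) = 1 ∧ (j : ℕ) = 0 then zetaC de ^ k
    else if i = j ∧ 2 ≤ (i : ℕ) then 1 else 0

/-- The permutation matrix `s_j` of the transposition `(j-1, j)` (1-indexed). -/
def sMat (n j : ℕ) : Matrix (Fin n) (Fin n) ℂ :=
  Matrix.of fun a b =>
    if ((a : ℕ) = j - 2 ∧ (b : ℕ) = j - 1) ∨ ((a : ℕ) = j - 1 ∧ (b : ℕ) = j - 2) then 1
    else if a = b ∧ (a : ℕ) ≠ j - 2 ∧ (a : ℕ) ≠ j - 1 then 1 else 0

/-- Decreasing-index product `s_i s_{i-1} ⋯ s_{i'}` (empty when `i < i'`). -/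
def sDescM (n i i' : ℕ) : Matrix (Fin n) (Fin n) ℂ :=
  (((List.range' i' (i + 1 - i')).reverse).map (sMat n)).prod

/-- Increasing-index product `s_{i'} s_{i'+1} ⋯ s_i` (empty when `i < i'`). -/
def sAscM (n i' i : ℕ) : Matrix (Fin n) (Fin n) ℂ :=
  ((List.range' i' (i + 1 - i')).map (sMat n)).prod

/-- Index type enumerating the `i·de` listed expressions of `Λ_i`:
`1`; `s_i ⋯ s_{i'}` for `3 ≤ i' ≤ i`; `s_i ⋯ s₃ t_k` for `0 ≤ k ≤ de-1`;
`s_i ⋯ s₃ t_k s₂ s₃ ⋯ s_{i'}` for `1 ≤ k ≤ de-1`, `2 ≤ i' ≤ i`. -/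
inductive LamIdx (de i : ℕ) : Type
  | one : LamIdx de i
  | sdesc (i' : ℕ) (h3 : 3 ≤ i') (hi : i' ≤ i) : LamIdx de i
  | st (k : ℕ) (hk : k < de) : LamIdx de i
  | stst (k : ℕ) (hk1 : 1 ≤ k) (hk : k < de) (i' : ℕ) (h2 : 2 ≤ i') (hi : i' ≤ i) : LamIdx de i

/-- Evaluation of a listed expression of `Λ_i` in `G(de,e,n)` (recall `s₂ = t₀`,
and `s₃ ⋯ s_{i'}` is the empty product when `i' = 2`). -/
def lamEvalM (d e n i : ℕ) : LamIdx (d * e) i → Matrix (Fin n) (Fin n) ℂ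
  | .one => 1
  | .sdesc i' _ _ => sDescM n i i'
  | .st k _ => sDescM n i 3 * tMat (d * e) n k
  | .stst k _ _ i' _ _ => sDescM n i 3 * tMat (d * e) n k * tMat (d * e) n 0 * sAscM n 3 i'

/-- Index of a normal form: an exponent `0 ≤ k ≤ d-1` together with one listed
expression of `Λ_i` for each `2 ≤ i ≤ n`. -/
def NFIdx (d e n : ℕ) : Type := Fin d × (∀ j : Fin (n - 1), LamIdx (d * e) (j.val + 2))

/-- The product `z^k · a₂ · a₃ ⋯ aₙ` associated with a normal form index. -/
def nfEval (d e n : ℕ) (p : NFIdx d e n) : Matrix (Fin n) (Fin n) ℂ :=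
  zMat d n ^ (p.1 : ℕ) *
    ((List.finRange (n - 1)).map (fun j : Fin (n - 1) => lamEvalM d e n (j.val + 2) (p.2 j))).prod


/-- The generating set `X = {z, t₀, …, t_{de-1}, s₃, …, sₙ}`. -/
def genX (d e n : ℕ) : Set (Matrix (Fin n) (Fin n) ℂ) :=
  {zMat d n} ∪ {x | ∃ k < d * e, x = tMat (d * e) n k} ∪
    {x | ∃ j, 3 ≤ j ∧ j ≤ n ∧ x = sMat n j}

/-- Minimal length of a word over `X` (no inverses) whose product is `w`. -/
def len {M : Type*} [Monoid M] (X : Set M) (w : M) : ℕ :=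
  sInf {k | ∃ l : List M, (∀ x ∈ l, x ∈ X) ∧ l.length = k ∧ l.prod = w}

/-- The number of letters of the defining word of a listed expression of `Λ_i`. -/
def lamWordLen (de i : ℕ) : LamIdx de i → ℕ
  | .one => 0
  | .sdesc i' _ _ => i - i' + 1
  | .st _ _ => (i - 2) + 1
  | .stst _ _ _ i' _ _ => (i - 2) + 2 + (i' - 2)

/-- The number of letters of the word obtained by concatenating `k` copies of `z`
with the defining words of `a₂, …, aₙ`. -/
def nfWordLen (d e n : ℕ) (p : NFIdx d e n) : ℕ :=
  (p.1 : ℕ) + ∑ j : Fin (n - 1), lamWordLen (d * e) (j.val + 2) (p.2 j)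

/-! ### States: a monomial matrix is recorded by its column function and its row values -/

/-- Swapping of the indices `r` and `r+1`. -/
def swR (r a : ℕ) : ℕ := if a = r then r + 1 else if a = r + 1 then r else a

/-- New values after a swap of rows `r`, `r+1` with multiplier `x`. -/
def actV (r : ℕ) (x : ℂ) (v : ℕ → ℂ) : ℕ → ℂ := fun a =>
  if a = r then x⁻¹ * v (r + 1) else if a = r + 1 then x * v r else v a

def actC (r : ℕ) (c : ℕ → ℕ) : ℕ → ℕ := fun a => c (swR r a)

structure RepM (n : ℕ) (w : Matrix (Fin n) (Fin n) ℂ) (c : ℕ → ℕ) (v : ℕ → ℂ) : Prop where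
  lt : ∀ a < n, c a < n
  inj : ∀ a < n, ∀ b < n, c a = c b → a = b
  nz : ∀ a < n, v a ≠ 0
  eq : ∀ i j : Fin n, w i j = if (j : ℕ) = c i then v i else 0

/-- Contribution of a pair of rows. -/
def pairP (c : ℕ → ℕ) (v : ℕ → ℂ) (a b : ℕ) : ℕ :=
  if c b < c a then 1 else if v b = 1 then 0 else 2

def rowG (c : ℕ → ℕ) (v : ℕ → ℂ) (b : ℕ) : ℕ := ∑ a ∈ Finset.range b, pairP c v a b

def totF (n : ℕ) (c : ℕ → ℕ) (v : ℕ → ℂ) : ℕ := ∑ b ∈ Finset.range n, rowG c v b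

lemma swR_left (r : ℕ) : swR r r = r + 1 := by simp [swR]
lemma swR_right (r : ℕ) : swR r (r + 1) = r := by simp [swR]
lemma swR_other (r a : ℕ) (h : a ≠ r) (h' : a ≠ r + 1) : swR r a = a := by simp [swR, h, h']
lemma swR_swR (r a : ℕ) : swR r (swR r a) = a := by unfold swR; split_ifs <;> omega
lemma swR_lt (r a n : ℕ) (hr : r + 1 < n) (ha : a < n) : swR r a < n := by
  unfold swR; split_ifs <;> omega

lemma rowG_lt (r : ℕ) (x : ℂ) (c : ℕ → ℕ) (v : ℕ → ℂ) (b : ℕ) (h : b < r) :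
    rowG (actC r c) (actV r x v) b = rowG c v b := by
  unfold rowG
  refine Finset.sum_congr rfl fun a ha => ?_
  have ha := Finset.mem_range.1 ha
  have h1 : a ≠ r := by omega
  have h2 : a ≠ r + 1 := by omega
  have h3 : b ≠ r := by omega
  have h4 : b ≠ r + 1 := by omega
  simp [pairP, actC, actV, swR, h1, h2, h3, h4]

lemma rowG_gt (r : ℕ) (x : ℂ) (c : ℕ → ℕ) (v : ℕ → ℂ) (b : ℕ) (h : r + 1 < b) :
    rowG (actC r c) (actV r x v) b = rowG c v b := by
  unfold rowG
  have h3 : b ≠ r := by omega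
  have h4 : b ≠ r + 1 := by omega
  refine Finset.sum_bij' (fun a _ => swR r a) (fun a _ => swR r a) ?_ ?_ ?_ ?_ ?_
  · intro a ha; exact Finset.mem_range.2 (swR_lt r a b h (Finset.mem_range.1 ha))
  · intro a ha; exact Finset.mem_range.2 (swR_lt r a b h (Finset.mem_range.1 ha))
  · intro a ha; exact swR_swR r a
  · intro a ha; exact swR_swR r a
  · intro a ha
    simp only [pairP, actC, actV, if_neg h3, if_neg h4, swR_other r b h3 h4]

lemma rowG_mid (r : ℕ) (x : ℂ) (hx : r = 0 ∨ x = 1) (c : ℕ → ℕ) (v : ℕ → ℂ) :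
    rowG (actC r c) (actV r x v) r + rowG (actC r c) (actV r x v) (r + 1) + pairP c v r (r + 1)
      = rowG c v r + rowG c v (r + 1) + pairP (actC r c) (actV r x v) r (r + 1) := by
  have e1 : rowG (actC r c) (actV r x v) (r + 1)
      = rowG c v r + pairP (actC r c) (actV r x v) r (r + 1) := by
    unfold rowG
    rw [Finset.sum_range_succ]
    congr 1
    refine Finset.sum_congr rfl fun a ha => ?_
    have ha := Finset.mem_range.1 ha
    have hx1 : x = 1 := by rcases hx with h | h; omega; exact h
    have h1 : a ≠ r := by omega
    have h2 : a ≠ r + 1 := by omega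
    simp [pairP, actC, actV, swR, h1, h2, hx1]
  have e2 : rowG c v (r + 1) = rowG (actC r c) (actV r x v) r + pairP c v r (r + 1) := by
    unfold rowG
    rw [Finset.sum_range_succ]
    congr 1
    refine Finset.sum_congr rfl fun a ha => ?_
    have ha := Finset.mem_range.1 ha
    have hx1 : x = 1 := by rcases hx with h | h; omega; exact h
    have h1 : a ≠ r := by omega
    have h2 : a ≠ r + 1 := by omega
    simp [pairP, actC, actV, swR, h1, h2, hx1]
  omega

lemma totF_act (r : ℕ) (x : ℂ) (hx : r = 0 ∨ x = 1) (c : ℕ → ℕ) (v : ℕ → ℂ) (n : ℕ)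
    (hn : r + 2 ≤ n) :
    totF n (actC r c) (actV r x v) + pairP c v r (r + 1)
      = totF n c v + pairP (actC r c) (actV r x v) r (r + 1) := by
  induction n, hn using Nat.le_induction with
  | base =>
    have h := rowG_mid r x hx c v
    have h2 : ∑ b ∈ Finset.range r, rowG (actC r c) (actV r x v) b
        = ∑ b ∈ Finset.range r, rowG c v b :=
      Finset.sum_congr rfl fun b hb => rowG_lt r x c v b (Finset.mem_range.1 hb)
    simp only [totF, Finset.sum_range_succ, h2]
    omega
  | succ m hm ih =>
    have h := rowG_gt r x c v m (by omega)
    simp only [totF, Finset.sum_range_succ, h] at ih ⊢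
    omega

lemma prod_act (r : ℕ) (x : ℂ) (hx0 : x ≠ 0) (v : ℕ → ℂ) (n : ℕ) (hn : r + 2 ≤ n) :
    ∏ b ∈ Finset.range n, actV r x v b = ∏ b ∈ Finset.range n, v b := by
  induction n, hn using Nat.le_induction with
  | base =>
    have h2 : ∏ b ∈ Finset.range r, actV r x v b = ∏ b ∈ Finset.range r, v b := by
      refine Finset.prod_congr rfl fun b hb => ?_
      have hb := Finset.mem_range.1 hb
      have h1 : b ≠ r := by omega
      have h2 : b ≠ r + 1 := by omega
      simp [actV, h1, h2]
    simp only [Finset.prod_range_succ, h2]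
    simp [actV]
    field_simp
  | succ m hm ih =>
    have h1 : m ≠ r := by omega
    have h2 : m ≠ r + 1 := by omega
    simp only [Finset.prod_range_succ, ih]
    simp [actV, h1, h2]

/-- The length statistic grows by at most one. -/
lemma totF_le (r : ℕ) (x : ℂ) (hx : r = 0 ∨ x = 1) (c : ℕ → ℕ) (v : ℕ → ℂ) (n : ℕ)
    (hn : r + 2 ≤ n) (hc : c r ≠ c (r + 1)) :
    totF n (actC r c) (actV r x v) ≤ totF n c v + 1 := by
  have h := totF_act r x hx c v n hn
  have : pairP (actC r c) (actV r x v) r (r + 1) ≤ pairP c v r (r + 1) + 1 := by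
    simp only [pairP, actC, swR_left, swR_right]
    split_ifs <;> omega
  omega

lemma totF_up (r : ℕ) (x : ℂ) (hx : r = 0 ∨ x = 1) (c : ℕ → ℕ) (v : ℕ → ℂ) (n : ℕ)
    (hn : r + 2 ≤ n) 
    (h : (c r < c (r + 1) ∧ v (r + 1) = 1) ∨ (c (r + 1) < c r ∧ x * v r ≠ 1)) :
    totF n (actC r c) (actV r x v) = totF n c v + 1 := by
  have h' := totF_act r x hx c v n hn
  have : pairP (actC r c) (actV r x v) r (r + 1) = pairP c v r (r + 1) + 1 := by
    have e : actV r x v (r + 1) = x * v r := by simp [actV]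
    simp only [pairP, actC, swR_left, swR_right, e]
    rcases h with ⟨h1, h2⟩ | ⟨h1, h2⟩
    · simp [h1, h2, not_lt.2 h1.le]
    · simp [h1, h2, not_lt.2 h1.le]
  omega

/-! ### Matrices -/

lemma mul_rows (n : ℕ) (m w : Matrix (Fin n) (Fin n) ℂ) (g c : ℕ → ℕ) (y v : ℕ → ℂ)
    (hg : ∀ a < n, g a < n)
    (hm : ∀ i j : Fin n, m i j = if (j : ℕ) = g i then y i else 0)
    (hw : ∀ i j : Fin n, w i j = if (j : ℕ) = c i then v i else 0) (i k : Fin n) :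
    (m * w) i k = if (k : ℕ) = c (g i) then y i * v (g i) else 0 := by
  rw [Matrix.mul_apply, Finset.sum_eq_single (⟨g i, hg i i.2⟩ : Fin n)]
  · rw [hm, hw]; simp
  · intro b _ hb
    rw [hm, if_neg, zero_mul]
    intro h; exact hb (Fin.ext h)
  · simp

lemma rep_one (n : ℕ) : RepM n 1 id (fun _ => 1) where
  lt := fun a h => h
  inj := fun a _ b _ h => h
  nz := fun _ _ => one_ne_zero
  eq := fun i j => by simp [Matrix.one_apply, Fin.ext_iff, eq_comm]

lemma zetaC_ne (m : ℕ) : zetaC m ≠ 0 := Complex.exp_ne_zero _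

lemma rep_act (n r : ℕ) (x : ℂ) (hx : x ≠ 0) (hr : r + 2 ≤ n) (m w : Matrix (Fin n) (Fin n) ℂ)
    (c : ℕ → ℕ) (v : ℕ → ℂ) (h : RepM n w c v)
    (hm : ∀ i j : Fin n, m i j = if (j : ℕ) = swR r i then
      (if (i : ℕ) = r then x⁻¹ else if (i : ℕ) = r + 1 then x else 1) else 0) :
    RepM n (m * w) (actC r c) (actV r x v) where
  lt := fun a ha => h.lt _ (swR_lt r a n (by omega) ha)
  inj := fun a ha b hb hab => by
    have := h.inj _ (swR_lt r a n (by omega) ha) _ (swR_lt r b n (by omega) hb) hab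
    rw [← swR_swR r a, this, swR_swR]
  nz := fun a ha => by
    have h1 := h.nz r (by omega)
    have h2 := h.nz (r + 1) (by omega)
    have h3 := h.nz a ha
    unfold actV
    split_ifs <;> simp [*]
  eq := fun i j => by
    rw [mul_rows n m w (swR r) c (fun i => if i = r then x⁻¹ else if i = r + 1 then x else 1) v
      (fun a ha => swR_lt r a n (by omega) ha) hm h.eq]
    unfold actC actV
    congr 1
    by_cases h1 : (i : ℕ) = r
    · simp [h1, swR]
    · by_cases h2 : (i : ℕ) = r + 1
      · simp [h2, swR]
      · simp [h1, h2, swR]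

lemma sMat_rows (n r : ℕ) (i j : Fin n) : sMat n (r + 2) i j = if (j : ℕ) = swR r i then
      (if (i : ℕ) = r then (1 : ℂ)⁻¹ else if (i : ℕ) = r + 1 then 1 else 1) else 0 := by
  have e : r + 2 - 1 = r + 1 := by omega
  simp only [sMat, Matrix.of_apply, Nat.add_sub_cancel, e, Fin.ext_iff, inv_one, ite_self, swR]
  by_cases h1 : (i : ℕ) = r
  · simp [h1]
  · by_cases h2 : (i : ℕ) = r + 1
    · simp [h2]
    · simp [h1, h2, eq_comm]

lemma tMat_rows (n de k : ℕ) (i j : Fin n) : tMat de n k i j = if (j : ℕ) = swR 0 i then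
      (if (i : ℕ) = 0 then (zetaC de ^ k)⁻¹ else if (i : ℕ) = 0 + 1 then zetaC de ^ k else 1)
      else 0 := by
  simp only [tMat, Matrix.of_apply, Fin.ext_iff, swR]
  by_cases h1 : (i : ℕ) = 0
  · simp [h1]
  · by_cases h2 : (i : ℕ) = 1
    · simp [h2]
    · have h3 : 2 ≤ (i : ℕ) := by omega
      simp [h1, h2, h3, eq_comm]

lemma rep_s (n r : ℕ) (hr : r + 2 ≤ n) (w : Matrix (Fin n) (Fin n) ℂ)
    (c : ℕ → ℕ) (v : ℕ → ℂ) (h : RepM n w c v) :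
    RepM n (sMat n (r + 2) * w) (actC r c) (actV r 1 v) :=
  rep_act n r 1 one_ne_zero hr _ w c v h (sMat_rows n r)

lemma rep_t (n de k : ℕ) (hn : 2 ≤ n) (w : Matrix (Fin n) (Fin n) ℂ)
    (c : ℕ → ℕ) (v : ℕ → ℂ) (h : RepM n w c v) :
    RepM n (tMat de n k * w) (actC 0 c) (actV 0 (zetaC de ^ k) v) :=
  rep_act n 0 _ (pow_ne_zero _ (zetaC_ne de)) (by omega) _ w c v h (tMat_rows n de k)

def zV (d : ℕ) (v : ℕ → ℂ) : ℕ → ℂ := fun a => (if a = 0 then zetaC d else 1) * v a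

lemma rep_z (n d : ℕ) (w : Matrix (Fin n) (Fin n) ℂ)
    (c : ℕ → ℕ) (v : ℕ → ℂ) (h : RepM n w c v) :
    RepM n (zMat d n * w) c (zV d v) where
  lt := h.lt
  inj := h.inj
  nz := fun a ha => by
    have h3 := h.nz a ha
    have h4 := zetaC_ne d
    unfold zV
    refine mul_ne_zero ?_ h3
    split_ifs
    · exact h4
    · exact one_ne_zero
  eq := fun i j => by
    rw [mul_rows n _ w id c (fun a => if a = 0 then zetaC d else 1) v (fun a ha => ha) ?_ h.eq]
    · rfl
    · intro i j
      simp only [zMat, Matrix.of_apply, Fin.ext_iff, id, eq_comm]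

lemma totF_z (n d : ℕ) (c : ℕ → ℕ) (v : ℕ → ℂ) : totF n c (zV d v) = totF n c v := by
  unfold totF
  refine Finset.sum_congr rfl fun b _ => ?_
  unfold rowG
  refine Finset.sum_congr rfl fun a ha => ?_
  have h : b ≠ 0 := by have := Finset.mem_range.1 ha; omega
  simp [pairP, zV, h]

lemma prod_z (n d : ℕ) (hn : 2 ≤ n) (v : ℕ → ℂ) :
    ∏ b ∈ Finset.range n, zV d v b = zetaC d * ∏ b ∈ Finset.range n, v b := by
  unfold zV
  rw [Finset.prod_mul_distrib, Finset.prod_ite_eq' (Finset.range n) 0 (fun _ => zetaC d)]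
  rw [if_pos (Finset.mem_range.2 (by omega))]

lemma rep_unique (n : ℕ) (w : Matrix (Fin n) (Fin n) ℂ) (c c' : ℕ → ℕ) (v v' : ℕ → ℂ)
    (h : RepM n w c v) (h' : RepM n w c' v') (a : ℕ) (ha : a < n) : c a = c' a ∧ v a = v' a := by
  have e := h.eq ⟨a, ha⟩ ⟨c a, h.lt a ha⟩
  have e' := h'.eq ⟨a, ha⟩ ⟨c a, h.lt a ha⟩
  rw [e] at e'
  simp only [if_true] at e'
  have := h.nz a ha
  by_cases hc : c a = c' a
  · rw [if_pos hc] at e'; exact ⟨hc, e'⟩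
  · rw [if_neg hc] at e'; exact absurd e' this

lemma totF_congr (n : ℕ) (c c' : ℕ → ℕ) (v v' : ℕ → ℂ)
    (h : ∀ a < n, c a = c' a ∧ v a = v' a) : totF n c v = totF n c' v' := by
  unfold totF
  refine Finset.sum_congr rfl fun b hb => ?_
  have hb := Finset.mem_range.1 hb
  unfold rowG
  refine Finset.sum_congr rfl fun a ha => ?_
  have ha := Finset.mem_range.1 ha
  unfold pairP
  rw [(h b hb).1, (h b hb).2, (h a (by omega)).1]

/-! ### Lower bound for all words -/

lemma word_bound (d e n : ℕ) (hn : 2 ≤ n) (l : List (Matrix (Fin n) (Fin n) ℂ))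
    (hl : ∀ x ∈ l, x ∈ genX d e n) :
    ∃ a b c v, RepM n l.prod c v ∧ totF n c v ≤ b ∧
      ∏ i ∈ Finset.range n, v i = zetaC d ^ a ∧ a + b = l.length := by
  induction l with
  | nil =>
    refine ⟨0, 0, id, fun _ => 1, by simpa using rep_one n, ?_, by simp, by simp⟩
    unfold totF rowG
    simp only [nonpos_iff_eq_zero]
    refine Finset.sum_eq_zero fun b _ => Finset.sum_eq_zero fun a ha => ?_
    have := Finset.mem_range.1 ha
    simp [pairP]; omega
  | cons x l ih =>
    obtain ⟨a, b, c, v, hR, hF, hP, hlen⟩ := ih fun y hy => hl y (List.mem_cons_of_mem _ hy)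
    have hx := hl x List.mem_cons_self
    rw [List.prod_cons]
    simp only [List.length_cons]
    rcases hx with (hx | ⟨k, hk, hx⟩) | ⟨j, h3, hj, hx⟩
    · rw [Set.mem_singleton_iff] at hx
      subst hx
      refine ⟨a + 1, b, c, zV d v, rep_z n d _ c v hR, ?_, ?_, by omega⟩
      · rw [totF_z]; exact hF
      · rw [prod_z n d hn, hP, pow_succ']
    · subst hx
      refine ⟨a, b + 1, _, _, rep_t n (d * e) k hn _ c v hR, ?_, ?_, by omega⟩
      · refine (totF_le 0 _ (Or.inl rfl) c v n (by omega) ?_).trans (by omega)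
        intro hc
        have := hR.inj 0 (by omega) (0 + 1) (by omega) hc
        omega
      · rw [prod_act _ _ (pow_ne_zero _ (zetaC_ne _)) _ _ (by omega), hP]
    · subst hx
      obtain ⟨r, rfl⟩ : ∃ r, j = r + 2 := ⟨j - 2, by omega⟩
      refine ⟨a, b + 1, _, _, rep_s n r hj _ c v hR, ?_, ?_, by omega⟩
      · refine (totF_le r _ (Or.inr rfl) c v n (by omega) ?_).trans (by omega)
        intro hc
        have := hR.inj r (by omega) (r + 1) (by omega) hc
        omega
      · rw [prod_act _ _ one_ne_zero _ _ (by omega), hP]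

/-! ### The normal form words -/

structure GoodW (d e n : ℕ) (w : Matrix (Fin n) (Fin n) ℂ) (a b : ℕ) (c : ℕ → ℕ) (v : ℕ → ℂ) :
    Prop where
  rep : RepM n w c v
  tot : totF n c v = b
  prd : ∏ i ∈ Finset.range n, v i = zetaC d ^ a
  word : ∃ l : List (Matrix (Fin n) (Fin n) ℂ), (∀ x ∈ l, x ∈ genX d e n) ∧
    l.length = a + b ∧ l.prod = w

lemma word_cons {M : Type*} [Monoid M] (X : Set M) (x w : M) (hx : x ∈ X) (k k' : ℕ)
    (hk : k' = k + 1)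
    (h : ∃ l : List M, (∀ x ∈ l, x ∈ X) ∧ l.length = k ∧ l.prod = w) :
    ∃ l : List M, (∀ x ∈ l, x ∈ X) ∧ l.length = k' ∧ l.prod = x * w := by
  obtain ⟨l, h1, h2, h3⟩ := h
  refine ⟨x :: l, ?_, by simp [h2, hk], by simp [h3]⟩
  intro y hy
  rcases List.mem_cons.1 hy with rfl | hy
  · exact hx
  · exact h1 y hy

variable {d e n : ℕ}

lemma good_z (hn : 2 ≤ n) {w : Matrix (Fin n) (Fin n) ℂ} {a b : ℕ} {c : ℕ → ℕ} {v : ℕ → ℂ}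
    (h : GoodW d e n w a b c v) : GoodW d e n (zMat d n * w) (a + 1) b c (zV d v) where
  rep := rep_z n d w c v h.rep
  tot := by rw [totF_z, h.tot]
  prd := by rw [prod_z n d hn, h.prd, pow_succ']
  word := word_cons (genX d e n) _ _ (Or.inl (Or.inl rfl)) (a + b) _ (by omega) h.word

lemma good_s {w : Matrix (Fin n) (Fin n) ℂ} {a b : ℕ} {c : ℕ → ℕ} {v : ℕ → ℂ} {r : ℕ}
    (h : GoodW d e n w a b c v) (hr1 : 1 ≤ r) (hr : r + 2 ≤ n)
    (hup : (c r < c (r + 1) ∧ v (r + 1) = 1) ∨ (c (r + 1) < c r ∧ v r ≠ 1)) :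
    GoodW d e n (sMat n (r + 2) * w) a (b + 1) (actC r c) (actV r 1 v) where
  rep := rep_s n r hr w c v h.rep
  tot := by rw [totF_up r 1 (Or.inr rfl) c v n hr (by simpa using hup), h.tot]
  prd := by rw [prod_act _ _ one_ne_zero _ _ hr, h.prd]
  word := word_cons (genX d e n) _ _ (Or.inr ⟨r + 2, by omega, hr, rfl⟩) (a + b) _ (by omega) h.word

lemma good_t {w : Matrix (Fin n) (Fin n) ℂ} {a b : ℕ} {c : ℕ → ℕ} {v : ℕ → ℂ} {k : ℕ}
    (h : GoodW d e n w a b c v) (hn : 2 ≤ n) (hk : k < d * e)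
    (hup : (c 0 < c 1 ∧ v 1 = 1) ∨ (c 1 < c 0 ∧ zetaC (d * e) ^ k * v 0 ≠ 1)) :
    GoodW d e n (tMat (d * e) n k * w) a (b + 1) (actC 0 c) (actV 0 (zetaC (d * e) ^ k) v) where
  rep := rep_t n (d * e) k hn w c v h.rep
  tot := by rw [totF_up 0 _ (Or.inl rfl) c v n (by omega) hup, h.tot]
  prd := by rw [prod_act _ _ (pow_ne_zero _ (zetaC_ne _)) _ _ (by omega), h.prd]
  word := word_cons (genX d e n) _ _ (Or.inl (Or.inr ⟨k, hk, rfl⟩)) (a + b) _ (by omega) h.word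

/-- The first `i` rows are increasing, with values `1` except possibly in row `0`. -/
def CondC (i : ℕ) (c : ℕ → ℕ) (v : ℕ → ℂ) : Prop :=
  (∀ a b, a < b → b < i → c a < c b) ∧ ∀ a, 1 ≤ a → a < i → v a = 1

def CondU (i r : ℕ) (c : ℕ → ℕ) (v : ℕ → ℂ) : Prop :=
  (∀ a b, a < b → b < i → a ≠ r → b ≠ r → c a < c b) ∧ (∀ a, 1 ≤ a → a < i → a ≠ r → v a = 1) ∧
    (v r ≠ 1 ∨ ∀ b, r < b → b < i → c r < c b)

def CondD (i r : ℕ) (c : ℕ → ℕ) (v : ℕ → ℂ) : Prop :=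
  (∀ a b, a < b → b < i → a ≠ r → b ≠ r → c a < c b) ∧ (∀ a, 1 ≤ a → a < i → v a = 1) ∧
    (∀ b, b < r → c b < c r)

lemma condU_step {i r : ℕ} {c : ℕ → ℕ} {v : ℕ → ℂ} (hr : 1 ≤ r) (hi : r + 1 < i)
    (h : CondU i r c v) : CondU i (r + 1) (actC r c) (actV r 1 v) := by
  obtain ⟨h1, h2, h3⟩ := h
  refine ⟨?_, ?_, ?_⟩
  · intro a b hab hb ha' hb'
    unfold actC swR
    split_ifs <;> apply h1 <;> omega
  · intro a ha hai har
    unfold actV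
    split_ifs with h4
    · simp [h2 (r + 1) (by omega) hi (by omega)]
    · exact h2 a ha hai h4
  · rcases h3 with h3 | h3
    · left; simpa [actV] using h3
    · right
      intro b hb hbi
      rw [actC, actC, swR_right, swR_other _ _ (by omega) (by omega)]
      exact h3 b (by omega) hbi

lemma condD_step {i r : ℕ} {c : ℕ → ℕ} {v : ℕ → ℂ} (hr : 1 ≤ r) (hi : r + 1 < i)
    (h : CondD i (r + 1) c v) : CondD i r (actC r c) (actV r 1 v) := by
  obtain ⟨h1, h2, h3⟩ := h
  refine ⟨?_, ?_, ?_⟩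
  · intro a b hab hb ha' hb'
    unfold actC swR
    split_ifs <;> apply h1 <;> omega
  · intro a ha hai
    unfold actV
    split_ifs with h4 h5
    · simp [h2 (r + 1) (by omega) hi]
    · simp [h2 r (by omega) (by omega)]
    · exact h2 a ha hai
  · intro b hb
    rw [actC, actC, swR_left, swR_other _ _ (by omega) (by omega)]
    exact h3 b (by omega)

lemma sDescM_succ (n m j : ℕ) (h : j ≤ m + 1) :
    sDescM n (m + 1) j = sMat n (m + 1) * sDescM n m j := by
  unfold sDescM
  have e : m + 1 + 1 - j = (m + 1 - j) + 1 := by omega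
  rw [e, List.range'_concat]
  have e2 : j + (m + 1 - j) = m + 1 := by omega
  simp [e2]

lemma sDescM_empty (n m : ℕ) : sDescM n m (m + 1) = 1 := by
  simp [sDescM]

lemma sAscM_succ (n m j : ℕ) (h : j ≤ m + 1) :
    sAscM n j (m + 1) = sAscM n j m * sMat n (m + 1) := by
  unfold sAscM
  have e : m + 1 + 1 - j = (m + 1 - j) + 1 := by omega
  rw [e, List.range'_concat]
  have e2 : j + (m + 1 - j) = m + 1 := by omega
  simp [e2]

lemma sAscM_empty (n m : ℕ) : sAscM n (m + 1) m = 1 := by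
  simp [sAscM]

lemma good_desc {w : Matrix (Fin n) (Fin n) ℂ} {a b : ℕ} {c : ℕ → ℕ} {v : ℕ → ℂ} {i r : ℕ}
    (hr : 1 ≤ r) (hin : i ≤ n) (h : GoodW d e n w a b c v) (hU : CondU i r c v) (m : ℕ)
    (hm : r ≤ m) (hmi : m < i) :
    ∃ c' v', GoodW d e n (sDescM n (m + 1) (r + 2) * w) a (b + (m - r)) c' v' ∧
      CondU i m c' v' := by
  induction m, hm using Nat.le_induction with
  | base =>
    refine ⟨c, v, ?_, hU⟩
    rw [sDescM_empty]; simpa using h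
  | succ m hm ih =>
    obtain ⟨c', v', hG, hU'⟩ := ih (by omega)
    refine ⟨_, _, ?_, condU_step (by omega) hmi hU'⟩
    rw [sDescM_succ _ _ _ (by omega), Matrix.mul_assoc]
    have e : b + (m + 1 - r) = b + (m - r) + 1 := by omega
    rw [e]
    refine good_s hG (by omega) (by omega) ?_
    obtain ⟨h1, h2, h3⟩ := hU'
    have hv := h2 (m + 1) (by omega) hmi (by omega)
    have hne : c' m ≠ c' (m + 1) := fun hc => by
      have := hG.rep.inj m (by omega) (m + 1) (by omega) hc
      omega
    rcases lt_or_gt_of_ne hne with h4 | h4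
    · exact Or.inl ⟨h4, hv⟩
    · right
      refine ⟨h4, ?_⟩
      rcases h3 with h3 | h3
      · exact h3
      · have := h3 (m + 1) (by omega) hmi
        omega

lemma good_asc {a : ℕ} {i : ℕ} (hin : i ≤ n) (r : ℕ) (hr : 1 ≤ r) (hri : r < i) :
    ∀ (w : Matrix (Fin n) (Fin n) ℂ) (b : ℕ) (c : ℕ → ℕ) (v : ℕ → ℂ),
    GoodW d e n w a b c v → CondD i r c v →
    ∃ c' v', GoodW d e n (sAscM n 3 (r + 1) * w) a (b + (r - 1)) c' v' ∧ CondD i 1 c' v' := by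
  induction r, hr using Nat.le_induction with
  | base =>
    intro w b c v h hD
    refine ⟨c, v, ?_, hD⟩
    rw [sAscM_empty]; simpa using h
  | succ r hr ih =>
    intro w b c v h hD
    have hG := good_s (r := r) h hr (by omega)
      (Or.inl ⟨hD.2.2 r (by omega), hD.2.1 (r + 1) (by omega) hri⟩)
    obtain ⟨c', v', hG', hD'⟩ := ih (by omega) _ _ _ _ hG (condD_step hr hri hD)
    refine ⟨c', v', ?_, hD'⟩
    rw [sAscM_succ _ _ _ (by omega), Matrix.mul_assoc]
    have e : b + (r + 1 - 1) = b + 1 + (r - 1) := by omega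
    rw [e]
    exact hG'

lemma condC_of_U {i : ℕ} {c : ℕ → ℕ} {v : ℕ → ℂ} (h : CondU (i + 1) i c v) : CondC i c v :=
  ⟨fun a b hab hb => h.1 a b hab (by omega) (by omega) (by omega),
    fun a ha hai => h.2.1 a ha (by omega) (by omega)⟩

lemma condU_of_C {i r : ℕ} {c : ℕ → ℕ} {v : ℕ → ℂ} (h : CondC i c v) : CondU i r c v :=
  ⟨fun a b hab hb _ _ => h.1 a b hab hb, fun a ha hai _ => h.2 a ha hai,
    Or.inr fun b hb hbi => h.1 r b hb hbi⟩

lemma condD_of_C {i r : ℕ} {c : ℕ → ℕ} {v : ℕ → ℂ} (hr : r < i) (h : CondC i c v) :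
    CondD i r c v :=
  ⟨fun a b hab hb _ _ => h.1 a b hab hb, fun a ha hai => h.2 a ha hai,
    fun b hb => h.1 b r hb hr⟩

lemma zetaC_pow_ne (m k : ℕ) (hk : 1 ≤ k) (hkm : k < m) : zetaC m ^ k ≠ 1 :=
  (Complex.isPrimitiveRoot_exp m (by omega)).pow_ne_one_of_pos_of_lt (by omega) hkm

lemma good_lam {w : Matrix (Fin n) (Fin n) ℂ} {a b : ℕ} {c : ℕ → ℕ} {v : ℕ → ℂ} {N : ℕ}
    (hin : N + 2 ≤ n) (h : GoodW d e n w a b c v) (hC : CondC (N + 2) c v)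
    (x : LamIdx (d * e) (N + 2)) :
    ∃ c' v', GoodW d e n (lamEvalM d e n (N + 2) x * w) a (b + lamWordLen (d * e) (N + 2) x) c' v' ∧
      CondC (N + 1) c' v' := by
  cases x with
  | one =>
    refine ⟨c, v, ?_, condC_of_U (condU_of_C hC)⟩
    simpa [lamEvalM, lamWordLen] using h
  | sdesc i' h3 hi =>
    obtain ⟨r, rfl⟩ : ∃ r, i' = r + 2 := ⟨i' - 2, by omega⟩
    obtain ⟨c', v', hG, hU⟩ := good_desc (by omega) hin h (condU_of_C (r := r) hC) (N + 1)
      (by omega) (by omega)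
    refine ⟨c', v', ?_, condC_of_U hU⟩
    have e1 : lamWordLen (d * e) (N + 2) (.sdesc (r + 2) h3 hi) = N + 1 - r := by
      simp only [lamWordLen]; omega
    rw [e1]; exact hG
  | st k hk =>
    have hG := good_t h (by omega) hk
      (Or.inl ⟨hC.1 0 1 (by omega) (by omega), hC.2 1 (by omega) (by omega)⟩)
    have hU : CondU (N + 2) 1 (actC 0 c) (actV 0 (zetaC (d * e) ^ k) v) := by
      refine ⟨?_, ?_, Or.inr ?_⟩
      · intro a b hab hb ha' hb'
        unfold actC swR
        split_ifs <;> apply hC.1 <;> omega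
      · intro a ha hai ha'
        rw [actV, if_neg (by omega), if_neg (by omega)]
        exact hC.2 a ha hai
      · intro b hb hbi
        unfold actC swR
        split_ifs <;> first | omega | (apply hC.1 <;> omega)
    obtain ⟨c', v', hG, hU⟩ := good_desc le_rfl hin hG hU (N + 1) (by omega) (by omega)
    refine ⟨c', v', ?_, condC_of_U hU⟩
    have e1 : b + lamWordLen (d * e) (N + 2) (.st k hk) = b + 1 + (N + 1 - 1) := by
      simp only [lamWordLen]; omega
    rw [e1]
    simp only [lamEvalM, Matrix.mul_assoc]
    exact hG
  | stst k hk1 hk i' h2 hi =>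
    obtain ⟨r, rfl⟩ : ∃ r, i' = r + 1 := ⟨i' - 1, by omega⟩
    obtain ⟨c1, v1, hG, hD⟩ := good_asc hin r (by omega) (by omega) _ _ _ _ h
      (condD_of_C (by omega) hC)
    obtain ⟨d1, d2, d3⟩ := hD
    have d4 := d3 0 (by omega)
    have d5 := d2 1 (by omega) (by omega)
    have hG := good_t (k := 0) hG (by omega) (by omega) (Or.inl ⟨d4, d5⟩)
    have hz := zetaC_pow_ne (d * e) k hk1 hk
    have hG := good_t hG (by omega) hk (Or.inr ⟨by simpa [actC, swR] using d4,
      by simpa [actV, d5] using hz⟩)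
    have hU : CondU (N + 2) 1 (actC 0 (actC 0 c1))
        (actV 0 (zetaC (d * e) ^ k) (actV 0 (zetaC (d * e) ^ 0) v1)) := by
      refine ⟨?_, ?_, Or.inl ?_⟩
      · intro a b hab hb ha' hb'
        unfold actC
        rw [swR_swR, swR_swR]
        exact d1 a b hab hb ha' hb'
      · intro a ha hai ha'
        rw [actV, if_neg (by omega), if_neg (by omega), actV, if_neg (by omega), if_neg (by omega)]
        exact d2 a ha hai
      · simpa [actV, d5] using hz
    obtain ⟨c', v', hG, hU⟩ := good_desc le_rfl hin hG hU (N + 1) (by omega) (by omega)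
    refine ⟨c', v', ?_, condC_of_U hU⟩
    have e1 : b + lamWordLen (d * e) (N + 2) (.stst k hk1 hk (r + 1) h2 hi)
        = b + (r - 1) + 1 + 1 + (N + 1 - 1) := by
      simp only [lamWordLen]; omega
    rw [e1]
    simp only [lamEvalM, Matrix.mul_assoc]
    exact hG

lemma good_prod {a : ℕ} (N : ℕ) (hN : N + 1 ≤ n) (p : ∀ j : Fin N, LamIdx (d * e) (j.val + 2)) :
    ∀ (w : Matrix (Fin n) (Fin n) ℂ) (b : ℕ) (c : ℕ → ℕ) (v : ℕ → ℂ),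
    GoodW d e n w a b c v → CondC (N + 1) c v →
    ∃ c' v', GoodW d e n (((List.finRange N).map
      (fun j : Fin N => lamEvalM d e n (j.val + 2) (p j))).prod * w) a
      (b + ∑ j : Fin N, lamWordLen (d * e) (j.val + 2) (p j)) c' v' := by
  induction N with
  | zero => intro w b c v h _; exact ⟨c, v, by simpa using h⟩
  | succ N ih =>
    intro w b c v h hC
    obtain ⟨c1, v1, hG, hC1⟩ := good_lam (by omega) h hC (p (Fin.last N))
    obtain ⟨c', v', hG'⟩ := ih (by omega) (fun j => p j.castSucc) _ _ _ _ hG hC1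
    refine ⟨c', v', ?_⟩
    rw [List.finRange_succ_last, Fin.sum_univ_castSucc]
    simp only [List.map_append, List.map_map, List.prod_append, List.map_cons, List.map_nil,
      List.prod_cons, List.prod_nil, mul_one, Matrix.mul_assoc]
    have e1 : ∀ A B : ℕ, b + (A + B) = b + B + A := by intro A B; omega
    rw [e1]
    exact hG'

lemma good_zpow (hn : 2 ≤ n) {w : Matrix (Fin n) (Fin n) ℂ} {b : ℕ} {c : ℕ → ℕ} {v : ℕ → ℂ}
    (h : GoodW d e n w 0 b c v) (k : ℕ) : ∃ v', GoodW d e n (zMat d n ^ k * w) k b c v' := by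
  induction k with
  | zero => exact ⟨v, by simpa using h⟩
  | succ k ih =>
    obtain ⟨v', hv⟩ := ih
    refine ⟨zV d v', ?_⟩
    rw [pow_succ', mul_assoc]
    exact good_z hn hv

lemma good_one : GoodW d e n 1 0 0 id (fun _ => 1) where
  rep := rep_one n
  tot := by
    unfold totF rowG
    refine Finset.sum_eq_zero fun b _ => Finset.sum_eq_zero fun a ha => ?_
    have := Finset.mem_range.1 ha
    simp [pairP]; omega
  prd := by simp
  word := ⟨[], by simp, by simp, by simp⟩

/-- The normal forms are geodesic: the concatenated word of the normal form of
`w ∈ G(de,e,n)` has exactly `ℓ(w)` letters. -/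
theorem normal_forms_are_geodesic (d e n : ℕ) (hd : 1 < d) (he : 1 < e) (hn : 2 ≤ n) :
    ∀ w ∈ Gdeen d e n, ∀ p : NFIdx d e n, nfEval d e n p = w →
      len (genX d e n) w = nfWordLen d e n p := by
  intro w _ p hp
  obtain ⟨c, v, hG⟩ := good_prod (d := d) (e := e) (n := n) (n - 1) (by omega) p.2 1 0 id
    (fun _ => 1) good_one ⟨fun a b h _ => h, fun _ _ _ => rfl⟩
  obtain ⟨v', hG⟩ := good_zpow hn hG (p.1 : ℕ)
  rw [mul_one, zero_add] at hG
  have hw : zMat d n ^ (p.1 : ℕ) * ((List.finRange (n - 1)).map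
    (fun j : Fin (n - 1) => lamEvalM d e n (j.val + 2) (p.2 j))).prod = w := hp
  rw [hw] at hG
  unfold len nfWordLen
  refine le_antisymm (Nat.sInf_le hG.word) (le_csInf ⟨_, hG.word⟩ ?_)
  rintro k ⟨l, hl, rfl, hlw⟩
  obtain ⟨a, b, c2, v2, hR, hF, hP, hlen⟩ := word_bound d e n hn l hl
  rw [hlw] at hR
  have hu := rep_unique n w c c2 v' v2 hG.rep hR
  have hF2 := totF_congr n c c2 v' v2 hu
  have hP2 : ∏ i ∈ Finset.range n, v' i = ∏ i ∈ Finset.range n, v2 i :=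
    Finset.prod_congr rfl fun i hi => (hu i (Finset.mem_range.1 hi)).2
  rw [hG.prd, hP] at hP2
  have hprim : IsPrimitiveRoot (zetaC d) d := Complex.isPrimitiveRoot_exp d (by omega)
  have hka : (p.1 : ℕ) ≤ a := by
    by_contra hlt
    have := hprim.pow_inj p.1.2 (by have := p.1.2; omega) hP2
    omega
  rw [← hlen]
  have := hG.tot
  omega
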